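/- arXiv:1804.01157 — 2 statements merged into one kernel-verified Lean document; each statement's English description precedes it below -/
import Mathlib

section
/- Let λ⁺, λ⁻, μ⁺, μ⁻ ∈ ℝ with μ⁺(λ⁺ + 2μ⁺) ≠ 0 and μ⁻(λ⁻ + 2μ⁻) ≠ 0, let n̄ = (n̄₁, n̄₂) ∈ ℝ² be a unit vector with t̄ = (n̄₂, −n̄₁), and set M̄⁻ = N(λ⁺,μ⁺,n̄)⁻¹·N(λ⁻,μ⁻,n̄) and M̄⁺ = N(λ⁻,μ⁻,n̄)⁻¹·N(λ⁺,μ⁺,n̄). Then for every 2×2 real matrix Φ and each s ∈ {+, −}, the 2×4 matrix (t̄ᵀ ⊗ Φ)·(M̄^s − I₄) is the zero matrix. -/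
open Matrix

noncomputable section

/-- The 4×4 matrix `N(λ,μ,n)` associated with the elasticity interface jump conditions. -/
def Nmat (lam mu n1 n2 : ℝ) : Matrix (Fin 4) (Fin 4) ℝ :=
  !![(lam + 2*mu)*n1, mu*n2, mu*n2, lam*n1;
     lam*n2, mu*n1, mu*n1, (lam + 2*mu)*n2;
     -n2, 0, n1, 0;
     0, -n2, 0, n1]

/-- The 2×4 Kronecker product `rᵀ ⊗ Φ = [r₁Φ, r₂Φ]` of a row vector with a 2×2 matrix. -/
def rowKron (r : Fin 2 → ℝ) (Φ : Matrix (Fin 2) (Fin 2) ℝ) : Matrix (Fin 2) (Fin 4) ℝ :=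
  !![r 0 * Φ 0 0, r 0 * Φ 0 1, r 1 * Φ 0 0, r 1 * Φ 0 1;
     r 0 * Φ 1 0, r 0 * Φ 1 1, r 1 * Φ 1 0, r 1 * Φ 1 1]

theorem Nmat_det (lam mu n1 n2 : ℝ) :
    (Nmat lam mu n1 n2).det = mu * (lam + 2*mu) * (n1^2 + n2^2)^2 := by
  simp [Nmat, det_succ_row_zero, Fin.sum_univ_succ, Fin.succAbove]
  ring

/-- The last two rows of `N(λ,μ,n)` do not involve `λ` and `μ`, so `t̄ᵀ ⊗ Φ` is the product
of `[0, -Φ]` with any `N(λ,μ,n)`. -/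
theorem rowKron_tangent_eq_mul_Nmat (lam mu n1 n2 : ℝ) (Φ : Matrix (Fin 2) (Fin 2) ℝ) :
    rowKron ![n2, -n1] Φ =
      !![0, 0, -Φ 0 0, -Φ 0 1; 0, 0, -Φ 1 0, -Φ 1 1] * Nmat lam mu n1 n2 := by
  ext i j
  fin_cases i <;> fin_cases j <;>
    simp [rowKron, Nmat, mul_apply, Fin.sum_univ_succ] <;> ring

theorem rowKron_tangent_mul_inv_Nmat_mul_sub_one (lam mu lam₂ mu₂ n1 n2 : ℝ)
    (h : mu * (lam + 2*mu) ≠ 0) (hn : n1^2 + n2^2 = 1) (Φ : Matrix (Fin 2) (Fin 2) ℝ) :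
    rowKron ![n2, -n1] Φ * ((Nmat lam mu n1 n2)⁻¹ * Nmat lam₂ mu₂ n1 n2 - 1) = 0 := by
  have hdet : IsUnit (Nmat lam mu n1 n2).det := by
    rw [Nmat_det, hn, one_pow, mul_one]
    exact h.isUnit
  rw [Matrix.mul_sub, Matrix.mul_one, sub_eq_zero]
  conv_lhs => rw [rowKron_tangent_eq_mul_Nmat lam mu]
  rw [Matrix.mul_assoc, mul_nonsing_inv_cancel_left _ _ hdet, ← rowKron_tangent_eq_mul_Nmat]

/-- `(t̄ᵀ ⊗ Φ)·(M̄^s − I₄) = 0` for every 2×2 matrix `Φ` and both signs `s`,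
where `M̄⁻ = (N⁺)⁻¹N⁻` and `M̄⁺ = (N⁻)⁻¹N⁺` and `t̄ = (n̄₂, −n̄₁)`. -/
theorem tangential_kron_annihilates_Mbar (lp mp lm mm n1 n2 : ℝ)
    (hp : mp * (lp + 2*mp) ≠ 0) (hm : mm * (lm + 2*mm) ≠ 0)
    (hn : n1^2 + n2^2 = 1) (Φ : Matrix (Fin 2) (Fin 2) ℝ) :
    rowKron ![n2, -n1] Φ * ((Nmat lp mp n1 n2)⁻¹ * Nmat lm mm n1 n2 - 1) = 0 ∧
    rowKron ![n2, -n1] Φ * ((Nmat lm mm n1 n2)⁻¹ * Nmat lp mp n1 n2 - 1) = 0 := by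
  exact ⟨rowKron_tangent_mul_inv_Nmat_mul_sub_one lp mp lm mm n1 n2 hp hn Φ,
    rowKron_tangent_mul_inv_Nmat_mul_sub_one lm mm lp mp n1 n2 hm hn Φ⟩
end
end

section
/- Let λ⁺, λ⁻, μ⁺, μ⁻ ∈ ℝ with μ⁺(λ⁺ + 2μ⁺) ≠ 0 and μ⁻(λ⁻ + 2μ⁻) ≠ 0, let n̄ = (n̄₁, n̄₂) ∈ ℝ² be a unit vector with t̄ = (n̄₂, −n̄₁), and set M̄⁺ = N(λ⁻,μ⁻,n̄)⁻¹·N(λ⁺,μ⁺,n̄). Let G⁺ and G⁻ be 2×2 real matrices with Vec(G⁻) = M̄⁺·Vec(G⁺). Then G⁺·t̄ = G⁻·t̄ and σ_{λ⁺,μ⁺}(G⁺)·n̄ = σ_{λ⁻,μ⁻}(G⁻)·n̄. Consequently, for any X̄ ∈ ℝ² and any v ∈ ℝ⁴, the piecewise linear vector field equal to G⁺·(X − X̄) on one side of the line l = {X : n̄·(X − X̄) = 0} and to G⁻·(X − X̄) on the other side (where Vec(G⁺) = v) is continuous across l and its stresses satisfy the jump condition σ_{λ⁺,μ⁺}(G⁺)·n̄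 = σ_{λ⁻,μ⁻}(G⁻)·n̄ on l. -/
open Matrix

noncomputable section

/-- Column-stacking vectorization of a 2×2 matrix: `Vec(G) = (G₁₁, G₂₁, G₁₂, G₂₂)ᵀ`. -/
def Vec2 (G : Matrix (Fin 2) (Fin 2) ℝ) : Fin 4 → ℝ := ![G 0 0, G 1 0, G 0 1, G 1 1]

/-- The stress matrix `σ_{λ,μ}(G) = λ·tr(G)·I₂ + μ·(G + Gᵀ)`. -/
def stress (lam mu : ℝ) (G : Matrix (Fin 2) (Fin 2) ℝ) : Matrix (Fin 2) (Fin 2) ℝ :=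
  (lam * G.trace) • (1 : Matrix (Fin 2) (Fin 2) ℝ) + mu • (G + Gᵀ)

theorem det_Nmat (lam mu n1 n2 : ℝ) :
    (Nmat lam mu n1 n2).det = mu * (lam + 2 * mu) * (n1 ^ 2 + n2 ^ 2) ^ 2 := by
  simp [Nmat, Matrix.det_succ_row_zero, Fin.sum_univ_succ, Fin.succAbove]
  ring

/-- `N(λ,μ,n)·Vec(G)` stacks the traction `σ_{λ,μ}(G)·n` on top of `-G·t`. -/
theorem Nmat_mulVec_Vec2 (lam mu n1 n2 : ℝ) (G : Matrix (Fin 2) (Fin 2) ℝ) :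
    (Nmat lam mu n1 n2).mulVec (Vec2 G) =
      ![(stress lam mu G).mulVec ![n1, n2] 0, (stress lam mu G).mulVec ![n1, n2] 1,
        -G.mulVec ![n2, -n1] 0, -G.mulVec ![n2, -n1] 1] := by
  ext i
  fin_cases i <;>
    simp [Nmat, Vec2, stress, Matrix.mulVec, dotProduct, Fin.sum_univ_four, Matrix.trace,
      Matrix.one_apply] <;> ring

/-- In the plane, a vector orthogonal to the unit vector `n` is a multiple of `t = (n₂, -n₁)`. -/
theorem eq_smul_tangent_of_dotProduct_eq_zero {n1 n2 : ℝ} (hn : n1 ^ 2 + n2 ^ 2 = 1)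
    {d : Fin 2 → ℝ} (hd : ![n1, n2] ⬝ᵥ d = 0) :
    d = (n2 * d 0 - n1 * d 1) • ![n2, -n1] := by
  simp [dotProduct, Fin.sum_univ_succ] at hd
  ext i
  fin_cases i
  · simp
    linear_combination n1 * hd - d 0 * hn
  · simp
    linear_combination n2 * hd - d 1 * hn

/-- if `Vec(G⁻) = M̄⁺·Vec(G⁺)` with `M̄⁺ = (N⁻)⁻¹N⁺`, then `G⁺·t̄ = G⁻·t̄` and
`σ_{λ⁺,μ⁺}(G⁺)·n̄ = σ_{λ⁻,μ⁻}(G⁻)·n̄`; consequently the piecewise linear field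
`X ↦ G^±·(X − X̄)` is continuous across the line `l = {X : n̄·(X − X̄) = 0}` and its stresses
satisfy the jump condition on `l`. -/
theorem piecewise_field_in_IFE_space (lp mp lm mm n1 n2 : ℝ)
    (hp : mp * (lp + 2*mp) ≠ 0) (hm : mm * (lm + 2*mm) ≠ 0)
    (hn : n1^2 + n2^2 = 1)
    (Gp Gm : Matrix (Fin 2) (Fin 2) ℝ)
    (hVec : Vec2 Gm = ((Nmat lm mm n1 n2)⁻¹ * Nmat lp mp n1 n2).mulVec (Vec2 Gp)) :
    Gp.mulVec ![n2, -n1] = Gm.mulVec ![n2, -n1] ∧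
    (stress lp mp Gp).mulVec ![n1, n2] = (stress lm mm Gm).mulVec ![n1, n2] ∧
    (∀ Xbar X : Fin 2 → ℝ, ![n1, n2] ⬝ᵥ (X - Xbar) = 0 →
      Gp.mulVec (X - Xbar) = Gm.mulVec (X - Xbar)) := by
  have hdet : IsUnit (Nmat lm mm n1 n2).det := by
    rw [det_Nmat, hn]
    simpa using hm
  have hN : (Nmat lm mm n1 n2).mulVec (Vec2 Gm) = (Nmat lp mp n1 n2).mulVec (Vec2 Gp) := by
    rw [hVec, Matrix.mulVec_mulVec, Matrix.mul_nonsing_inv_cancel_left _ _ hdet]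
  rw [Nmat_mulVec_Vec2, Nmat_mulVec_Vec2] at hN
  have ht : Gp.mulVec ![n2, -n1] = Gm.mulVec ![n2, -n1] := by
    ext i
    fin_cases i
    · exact (neg_injective (congrFun hN 2)).symm
    · exact (neg_injective (congrFun hN 3)).symm
  refine ⟨ht, ?_, fun Xbar X hX => ?_⟩
  · ext i
    fin_cases i
    · exact (congrFun hN 0).symm
    · exact (congrFun hN 1).symm
  · rw [eq_smul_tangent_of_dotProduct_eq_zero hn hX, Matrix.mulVec_smul, Matrix.mulVec_smul, ht]
end
end
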